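/- Let m > 0 and e be real constants, let φ : ℝ³ → ℝ be smooth (time-independent), and set h(q, p) = |p|²/(2m) + e·φ(q). Suppose smooth functions Π_i, Πⁱ (i = 1,2,3) on ℝ × (ℝ³ × ℝ³) satisfy the momentum-Vlasov equations ∂Π_i/∂t = −X_h(Π_i) + e·Σ_j (∂²φ/∂q_i∂q_j)·Πʲ and ∂Πⁱ/∂t = −X_h(Πⁱ) − (1/m)·Π_i. Then, eliminating the dq-components Π_i, the dp-components satisfy the second-order Euler–Lagrange equations ∂²Πⁱ/∂t² + 2·X_h(∂Πⁱ/∂t) + X_h(X_h(Πⁱ)) + (e/m)·Σ_k (∂²φ/∂q_i∂q_k)·Πᵏ = 0 for each i. -/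

import Mathlib

open MeasureTheory

noncomputable section

/-- Position/momentum 3-space. -/
abbrev V3 : Type := Fin 3 → ℝ

/-- Phase space `ℝ³ × ℝ³` with coordinates `z = (q, p)`. -/
abbrev Phase : Type := V3 × V3

/-- Partial derivative in the `i`-th position variable `q i`. -/
def pq (i : Fin 3) (F : Phase → ℝ) (z : Phase) : ℝ :=
  deriv (fun s => F (Function.update z.1 i s, z.2)) (z.1 i)

/-- Partial derivative in the `i`-th momentum variable `p i`. -/
def pp (i : Fin 3) (F : Phase → ℝ) (z : Phase) : ℝ :=
  deriv (fun s => F (z.1, Function.update z.2 i s)) (z.2 i)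

/-- Partial derivative of a function on `ℝ³`. -/
def dq3 (i : Fin 3) (g : V3 → ℝ) (q : V3) : ℝ :=
  deriv (fun s => g (Function.update q i s)) (q i)

/-- Action of the Hamiltonian vector field of `a` on the function `F`:
`X_a(F) = Σᵢ (∂a/∂pᵢ ∂F/∂qᵢ − ∂a/∂qᵢ ∂F/∂pᵢ)`. -/
def Xact (a F : Phase → ℝ) (z : Phase) : ℝ :=
  ∑ i : Fin 3, (pp i a z * pq i F z - pq i a z * pp i F z)
/-- Coordinates of the Hamiltonian vector field of `a` at `z`. -/
def hamVec (a : Phase → ℝ) (z : Phase) : Phase :=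
  ∑ i : Fin 3, (pp i a z • ((Pi.single i 1, 0) : Phase) - pq i a z • ((0, Pi.single i 1) : Phase))

lemma pq_eq_fderiv (i : Fin 3) {F : Phase → ℝ} {z : Phase} (hF : DifferentiableAt ℝ F z) :
    pq i F z = fderiv ℝ F z (Pi.single i 1, 0) := by
  have hc : HasDerivAt (fun s : ℝ => ((Function.update z.1 i s, z.2) : Phase))
      (Pi.single i 1, 0) (z.1 i) :=
    (hasDerivAt_update z.1 i (z.1 i)).prodMk (hasDerivAt_const _ _)
  exact (hF.hasFDerivAt.comp_hasDerivAt_of_eq (z.1 i) hc (by simp)).deriv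

lemma pp_eq_fderiv (i : Fin 3) {F : Phase → ℝ} {z : Phase} (hF : DifferentiableAt ℝ F z) :
    pp i F z = fderiv ℝ F z (0, Pi.single i 1) := by
  have hc : HasDerivAt (fun s : ℝ => ((z.1, Function.update z.2 i s) : Phase))
      (0, Pi.single i 1) (z.2 i) :=
    (hasDerivAt_const _ _).prodMk (hasDerivAt_update z.2 i (z.2 i))
  exact (hF.hasFDerivAt.comp_hasDerivAt_of_eq (z.2 i) hc (by simp)).deriv

lemma Xact_eq_fderiv (a : Phase → ℝ) {F : Phase → ℝ} {z : Phase} (hF : DifferentiableAt ℝ F z) :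
    Xact a F z = fderiv ℝ F z (hamVec a z) := by
  simp only [Xact, hamVec, map_sum, map_sub, map_smul, smul_eq_mul, pq_eq_fderiv _ hF,
    pp_eq_fderiv _ hF]

lemma fderiv_slice {G : ℝ × Phase → ℝ} (hG : Differentiable ℝ G) (t : ℝ) (z v : Phase) :
    fderiv ℝ (fun w => G (t, w)) z v = fderiv ℝ G (t, z) (0, v) := by
  have hc : HasFDerivAt (fun w : Phase => (t, w)) (ContinuousLinearMap.inr ℝ ℝ Phase) z :=
    hasFDerivAt_prodMk_right t z
  have := ((hG (t, z)).hasFDerivAt.comp z hc).fderiv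
  exact DFunLike.congr_fun this v

lemma hasDerivAt_slice {G : ℝ × Phase → ℝ} (hG : Differentiable ℝ G) (t : ℝ) (z : Phase) :
    HasDerivAt (fun s => G (s, z)) (fderiv ℝ G (t, z) (1, 0)) t := by
  have hc : HasDerivAt (fun s : ℝ => (s, z)) (1, 0) t :=
    (hasDerivAt_id t).prodMk (hasDerivAt_const t z)
  exact (hG (t, z)).hasFDerivAt.comp_hasDerivAt t hc

lemma fderiv_fderiv_apply_comm {E : Type*} [NormedAddCommGroup E] [NormedSpace ℝ E] {G : E → ℝ}
    (hG : ContDiff ℝ 2 G) (x v w : E) :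
    fderiv ℝ (fun y => fderiv ℝ G y v) x w = fderiv ℝ (fun y => fderiv ℝ G y w) x v := by
  have hd : DifferentiableAt ℝ (fderiv ℝ G) x :=
    (hG.fderiv_right (m := 1) (by norm_num)).differentiable (by norm_num) x
  rw [fderiv_clm_apply hd (differentiableAt_const v), fderiv_clm_apply hd (differentiableAt_const w)]
  simpa using (hG.contDiffAt (x := x)).isSymmSndFDerivAt (by simp) w v

lemma differentiable_fderiv_apply {E : Type*} [NormedAddCommGroup E] [NormedSpace ℝ E] {G : E → ℝ}
    (hG : ContDiff ℝ 2 G) (v : E) : Differentiable ℝ (fun y => fderiv ℝ G y v) :=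
  ((hG.fderiv_right (m := 1) (by norm_num)).differentiable (by norm_num)).clm_apply
    (differentiable_const v)

lemma differentiable_time_deriv {P : ℝ → Phase → ℝ}
    (hP : ContDiff ℝ 2 (fun x : ℝ × Phase => P x.1 x.2)) (t : ℝ) :
    Differentiable ℝ (fun w => deriv (fun s => P s w) t) := by
  have hd := hP.differentiable (by norm_num)
  have h1 : (fun w => deriv (fun s => P s w) t) =
      fun w => fderiv ℝ (fun x : ℝ × Phase => P x.1 x.2) (t, w) (1, 0) :=
    funext fun w => (hasDerivAt_slice hd t w).deriv
  rw [h1]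
  exact (differentiable_fderiv_apply hP (1, 0)).comp
    ((differentiable_const t).prodMk differentiable_id)

/-- The action of a time-independent Hamiltonian vector field commutes with time derivatives. -/
lemma hasDerivAt_Xact (a : Phase → ℝ) {P : ℝ → Phase → ℝ}
    (hP : ContDiff ℝ 2 (fun x : ℝ × Phase => P x.1 x.2)) (t : ℝ) (z : Phase) :
    HasDerivAt (fun s => Xact a (P s) z) (Xact a (fun w => deriv (fun s => P s w) t) z) t := by
  have hd := hP.differentiable (by norm_num)
  have hslice : ∀ s, Differentiable ℝ (P s) := fun s =>
    hd.comp ((differentiable_const s).prodMk differentiable_id)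
  have h1 : (fun s => Xact a (P s) z) =
      fun s => fderiv ℝ (fun x : ℝ × Phase => P x.1 x.2) (s, z) (0, hamVec a z) :=
    funext fun s => (Xact_eq_fderiv a (hslice s z)).trans (fderiv_slice hd s z _)
  have h2 : (fun w => deriv (fun s => P s w) t) =
      fun w => fderiv ℝ (fun x : ℝ × Phase => P x.1 x.2) (t, w) (1, 0) :=
    funext fun w => (hasDerivAt_slice hd t w).deriv
  rw [Xact_eq_fderiv a (differentiable_time_deriv hP t z), h1, h2,
    fderiv_slice (differentiable_fderiv_apply hP (1, 0)) t z, fderiv_fderiv_apply_comm hP]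
  exact hasDerivAt_slice (differentiable_fderiv_apply hP (0, hamVec a z)) t z

/-- eliminating the `dq`-components `Πᵢ` from the momentum-Vlasov
equations, the `dp`-components `Πⁱ` satisfy the second-order Euler–Lagrange
equations `Π̈ⁱ + 2 X_h(Π̇ⁱ) + X_h(X_h(Πⁱ)) + (e/m) Σ_k (∂²φ/∂qᵢ∂q_k) Πᵏ = 0`. -/
theorem momentum_vlasov_euler_lagrange
    (m e : ℝ) (hm : 0 < m)
    (φ : V3 → ℝ) (hφ : ContDiff ℝ (⊤ : ℕ∞) φ)
    (h : Phase → ℝ)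
    (hh : ∀ z, h z = (∑ i : Fin 3, (z.2 i) ^ 2) / (2 * m) + e * φ z.1)
    (Pq Pp : Fin 3 → ℝ → Phase → ℝ)
    (hPq : ∀ i, ContDiff ℝ (⊤ : ℕ∞) (fun x : ℝ × Phase => Pq i x.1 x.2))
    (hPp : ∀ i, ContDiff ℝ (⊤ : ℕ∞) (fun x : ℝ × Phase => Pp i x.1 x.2))
    (heq1 : ∀ i t z, deriv (fun s => Pq i s z) t =
      -Xact h (Pq i t) z
        + e * ∑ j : Fin 3, dq3 i (fun q => dq3 j φ q) z.1 * Pp j t z)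
    (heq2 : ∀ i t z, deriv (fun s => Pp i s z) t =
      -Xact h (Pp i t) z - (1 / m) * Pq i t z) :
    ∀ (i : Fin 3) (t : ℝ) (z : Phase),
      deriv (fun s => deriv (fun r => Pp i r z) s) t
        + 2 * Xact h (fun w => deriv (fun s => Pp i s w) t) z
        + Xact h (fun w => Xact h (Pp i t) w) z
        + (e / m) * ∑ k : Fin 3,
            dq3 i (fun q => dq3 k φ q) z.1 * Pp k t z = 0 := by
  intro i t z
  have hP := (hPp i).of_le (m := 2) (WithTop.coe_le_coe.2 (le_top : (2 : ℕ∞) ≤ ⊤))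
  have hQ := (hPq i).differentiable (by simp)
  have hQt : Differentiable ℝ (Pq i t) :=
    hQ.comp ((differentiable_const t).prodMk differentiable_id)
  have hPt := differentiable_time_deriv hP t
  have htt : deriv (fun s => deriv (fun r => Pp i r z) s) t =
      -Xact h (fun w => deriv (fun s => Pp i s w) t) z
        - (1 / m) * deriv (fun s => Pq i s z) t := by
    simp only [heq2 i _ z]
    exact ((hasDerivAt_Xact h hP t z).neg.sub
      ((hasDerivAt_slice hQ t z).differentiableAt.hasDerivAt.const_mul (1 / m))).deriv
  have hXX : Xact h (fun w => Xact h (Pp i t) w) z =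
      -Xact h (fun w => deriv (fun s => Pp i s w) t) z - (1 / m) * Xact h (Pq i t) z := by
    have hX : (fun w => Xact h (Pp i t) w) =
        fun w => -deriv (fun s => Pp i s w) t - (1 / m) * Pq i t w :=
      funext fun w => by linarith [heq2 i t w]
    have hd := (hPt z).hasFDerivAt.fun_neg.fun_sub ((hQt z).hasFDerivAt.const_mul (1 / m))
    rw [hX, Xact_eq_fderiv h hd.differentiableAt, Xact_eq_fderiv h (hPt z),
      Xact_eq_fderiv h (hQt z), hd.fderiv]
    simp
  rw [htt, hXX, heq1]
  ring
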